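/- Let d ≥ 1, let I₁, I₂ ⊂ ℝ^d be relatively separated sets, let s₁, s₂ > d, and let 𝒜₁ = 𝒥_{s₁}(I₁) and 𝒜₂ = 𝒥_{s₂}(I₂) be the corresponding Jaffard algebras. Then 𝒜 = Ã₁ ∩ Ã₂ is inverse-closed: if A ∈ 𝒜 acts as a boundedly invertible operator on ℓ²(I₁×I₂), then the rank-four tensor whose entry B_{i,k,n,m} equals the ((i,k),(m,n)) matrix entry of A⁻¹ also belongs to 𝒜. -/

import Mathlib

open scoped ComplexConjugate

noncomputable section

namespace PaperTensor

variable {I I₁ I₂ : Type*}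

/-- The space `ℓ²(I)`. -/
abbrev L2 (I : Type*) := lp (fun _ : I => ℂ) 2

/-- The continuous linear map `T` represents the matrix `M` as an operator on `ℓ²(I)`,
i.e. `(T c) k = Σ_l M k l * c l` for every `c ∈ ℓ²(I)`. -/
def Represents (M : I → I → ℂ) (T : L2 I →L[ℂ] L2 I) : Prop :=
  ∀ c : L2 I, ∀ k : I, HasSum (fun l : I => M k l * (c : ∀ _ : I, ℂ) l) ((T c : ∀ _ : I, ℂ) k)

/-- `M` defines a bounded operator on `ℓ²(I)`. -/
def Bounded2 (M : I → I → ℂ) : Prop := ∃ T : L2 I →L[ℂ] L2 I, Represents M T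

/-- The operator norm `‖M‖_{B(ℓ²(I))}` of the matrix `M` (junk value `0` if `M` is unbounded). -/
noncomputable def opNorm2 (M : I → I → ℂ) : ℝ :=
  letI : Decidable (Bounded2 M) := Classical.propDecidable _
  if h : Bounded2 M then ‖h.choose‖ else 0

/-- The matrix product of two infinite matrices. -/
noncomputable def matMul (A B : I → I → ℂ) : I → I → ℂ :=
  fun i j => ∑' m : I, A i m * B m j

/-- The conjugate transpose of a matrix. -/
def conjTranspose (A : I → I → ℂ) : I → I → ℂ := fun i j => conj (A j i)

/-- A solid Banach algebra of (infinite) matrices over the index set `I`. -/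
structure SolidBanachAlgebra (I : Type*) where
  carrier : Set (I → I → ℂ)
  anorm : (I → I → ℂ) → ℝ
  zero_mem : (0 : I → I → ℂ) ∈ carrier
  add_mem : ∀ A B : I → I → ℂ, A ∈ carrier → B ∈ carrier → A + B ∈ carrier
  smul_mem : ∀ (c : ℂ) (A : I → I → ℂ), A ∈ carrier → c • A ∈ carrier
  mul_mem : ∀ A B : I → I → ℂ, A ∈ carrier → B ∈ carrier → matMul A B ∈ carrier
  anorm_nonneg : ∀ A ∈ carrier, 0 ≤ anorm A
  anorm_zero : anorm 0 = 0
  anorm_eq_zero : ∀ A ∈ carrier, anorm A = 0 → A = 0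
  anorm_smul : ∀ (c : ℂ), ∀ A ∈ carrier, anorm (c • A) = ‖c‖ * anorm A
  anorm_add : ∀ A ∈ carrier, ∀ B ∈ carrier, anorm (A + B) ≤ anorm A + anorm B
  anorm_mul : ∀ A ∈ carrier, ∀ B ∈ carrier, anorm (matMul A B) ≤ anorm A * anorm B
  complete : ∀ f : ℕ → (I → I → ℂ), (∀ n, f n ∈ carrier) →
      (∀ ε > (0 : ℝ), ∃ N : ℕ, ∀ m ≥ N, ∀ n ≥ N, anorm (f m - f n) < ε) →
      ∃ A ∈ carrier, ∀ ε > (0 : ℝ), ∃ N : ℕ, ∀ n ≥ N, anorm (f n - A) < ε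
  bounded : ∀ A ∈ carrier, Bounded2 A
  solid : ∀ A ∈ carrier, ∀ B : I → I → ℂ,
      (∀ i j, ‖B i j‖ ≤ ‖A i j‖) → B ∈ carrier ∧ anorm B ≤ anorm A

/-- A matrix algebra is involutive if it is closed under conjugate transposition and the
norm is invariant under it. -/
def SolidBanachAlgebra.Involutive (𝒜 : SolidBanachAlgebra I) : Prop :=
  ∀ A ∈ 𝒜.carrier, conjTranspose A ∈ 𝒜.carrier ∧ 𝒜.anorm (conjTranspose A) = 𝒜.anorm A

/-- Rank-four tensors `(A_{i,k,l,j})` indexed by `I₁ × I₂² × I₁`. -/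
abbrev Tensor (I₁ I₂ : Type*) := I₁ → I₂ → I₂ → I₁ → ℂ

/-- The restriction `A|_{{i} × I₂² × {j}}`, an `I₂ × I₂` matrix. -/
def res1 (A : Tensor I₁ I₂) (i j : I₁) : I₂ → I₂ → ℂ := fun k l => A i k l j

/-- The restriction `A|_{I₁ × {(k,l)} × I₁}`, an `I₁ × I₁` matrix. -/
def res2 (A : Tensor I₁ I₂) (k l : I₂) : I₁ → I₁ → ℂ := fun i j => A i k l j

/-- Membership in `Ã₁`, for a set `S` of `I₁ × I₁` matrices playing the role of `𝒜₁`: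
all restrictions `A|_{{i} × I₂² × {j}}` are bounded on `ℓ²(I₂)` and the matrix of their
operator norms belongs to `S`. -/
def MemT1 (S : Set (I₁ → I₁ → ℂ)) (A : Tensor I₁ I₂) : Prop :=
  (∀ i j : I₁, Bounded2 (res1 A i j)) ∧
    (fun i j : I₁ => (opNorm2 (res1 A i j) : ℂ)) ∈ S

/-- Membership in `Ã₂`. -/
def MemT2 (S : Set (I₂ → I₂ → ℂ)) (A : Tensor I₁ I₂) : Prop :=
  (∀ k l : I₂, Bounded2 (res2 A k l)) ∧
    (fun k l : I₂ => (opNorm2 (res2 A k l) : ℂ)) ∈ S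

/-- The norm `‖A‖_{Ã₁}` (meaningful on members of `Ã₁`). -/
noncomputable def normT1 (𝒜₁ : SolidBanachAlgebra I₁) (A : Tensor I₁ I₂) : ℝ :=
  𝒜₁.anorm (fun i j : I₁ => (opNorm2 (res1 A i j) : ℂ))

/-- The norm `‖A‖_{Ã₂}` (meaningful on members of `Ã₂`). -/
noncomputable def normT2 (𝒜₂ : SolidBanachAlgebra I₂) (A : Tensor I₁ I₂) : ℝ :=
  𝒜₂.anorm (fun k l : I₂ => (opNorm2 (res2 A k l) : ℂ))

/-- Membership in `𝒜 = Ã₁ ∩ Ã₂`. -/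
def MemA (𝒜₁ : SolidBanachAlgebra I₁) (𝒜₂ : SolidBanachAlgebra I₂) (A : Tensor I₁ I₂) : Prop :=
  MemT1 𝒜₁.carrier A ∧ MemT2 𝒜₂.carrier A

/-- The norm `‖A‖_𝒜 = max {‖A‖_{Ã₁}, ‖A‖_{Ã₂}}`. -/
noncomputable def normA (𝒜₁ : SolidBanachAlgebra I₁) (𝒜₂ : SolidBanachAlgebra I₂)
    (A : Tensor I₁ I₂) : ℝ :=
  max (normT1 𝒜₁ A) (normT2 𝒜₂ A)

/-- The matrix over `I₁ × I₂` through which a rank-four tensor acts on `ℓ²(I₁ × I₂)`: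
`(Ac)_{(i,k)} = Σ_{(m,n)} A_{i,k,n,m} c_{(m,n)}`. -/
def toMatrix (A : Tensor I₁ I₂) : (I₁ × I₂) → (I₁ × I₂) → ℂ :=
  fun p q => A p.1 p.2 q.2 q.1

/-- The rank-four tensor of matrix entries of an operator `T` on `ℓ²(I₁ × I₂)`:
its `(i,k,l,j)` entry is the `((i,k),(j,l))` matrix entry of `T`. -/
noncomputable def entryTensor (T : L2 (I₁ × I₂) →L[ℂ] L2 (I₁ × I₂)) : Tensor I₁ I₂ :=
  letI : DecidableEq (I₁ × I₂) := Classical.decEq _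
  fun i k l j => (T (lp.single 2 (j, l) (1 : ℂ)) : ∀ _ : I₁ × I₂, ℂ) (i, k)

/-- A set `S` of rank-four tensors is inverse-closed if, whenever `A ∈ S` acts as a boundedly
invertible operator on `ℓ²(I₁ × I₂)`, the rank-four tensor of matrix entries of the inverse
operator also belongs to `S`. -/
def InverseClosed (S : Set (Tensor I₁ I₂)) : Prop :=
  ∀ A ∈ S, ∀ T Tinv : L2 (I₁ × I₂) →L[ℂ] L2 (I₁ × I₂),
    Represents (toMatrix A) T →
    T.comp Tinv = ContinuousLinearMap.id ℂ (L2 (I₁ × I₂)) →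
    Tinv.comp T = ContinuousLinearMap.id ℂ (L2 (I₁ × I₂)) →
    entryTensor Tinv ∈ S

/-- The doubly contracted tensor product
`(A : B)_{i,k,l,j} = Σ_{n ∈ I₂} Σ_{m ∈ I₁} A_{i,k,n,m} B_{m,n,l,j}`. -/
noncomputable def contract (A B : Tensor I₁ I₂) : Tensor I₁ I₂ :=
  fun i k l j => ∑' n : I₂, ∑' m : I₁, A i k n m * B m n l j

/-- Absolute convergence of all series defining the doubly contracted tensor product. -/
def ContractSummable (A B : Tensor I₁ I₂) : Prop :=
  ∀ (i : I₁) (k l : I₂) (j : I₁),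
    Summable (fun nm : I₂ × I₁ => ‖A i k nm.1 nm.2 * B nm.2 nm.1 l j‖)

/-- The adjoint tensor `(A*)_{i,k,l,j} = conj (A_{j,l,k,i})`. -/
def adjT (A : Tensor I₁ I₂) : Tensor I₁ I₂ := fun i k l j => conj (A j l k i)



/-- A subset `I ⊂ ℝ^d` is relatively separated if the number of its points in any cube
`x + [0,1]^d` is uniformly bounded. -/
def RelSeparated {d : ℕ} (I : Set (EuclideanSpace ℝ (Fin d))) : Prop :=
  ∃ N : ℕ, ∀ x : EuclideanSpace ℝ (Fin d),
    (I ∩ {y | ∀ t : Fin d, y t ∈ Set.Icc (x t) (x t + 1)}).Finite ∧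
    (I ∩ {y | ∀ t : Fin d, y t ∈ Set.Icc (x t) (x t + 1)}).ncard ≤ N

/-- The Jaffard algebra `𝒥_s(I)`: matrices with `sup_{i,j} |A_{i,j}| (1+|i-j|)^s < ∞`. -/
def JaffardSet {d : ℕ} (I : Set (EuclideanSpace ℝ (Fin d))) (s : ℝ) :
    Set (↥I → ↥I → ℂ) :=
  {A | ∃ C : ℝ, ∀ i j : ↥I,
    ‖A i j‖ * (1 + ‖(i : EuclideanSpace ℝ (Fin d)) - (j : EuclideanSpace ℝ (Fin d))‖) ^ s ≤ C}

/-- The weighted Schur algebra `𝒮¹_δ(I)`: matrices whose weighted row and column sums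
are uniformly bounded. -/
def SchurSet {d : ℕ} (I : Set (EuclideanSpace ℝ (Fin d))) (δ : ℝ) :
    Set (↥I → ↥I → ℂ) :=
  {A | (∀ i : ↥I, Summable fun j : ↥I =>
          ‖A i j‖ * (1 + ‖(i : EuclideanSpace ℝ (Fin d)) - (j : EuclideanSpace ℝ (Fin d))‖) ^ δ) ∧
       (∀ j : ↥I, Summable fun i : ↥I =>
          ‖A i j‖ * (1 + ‖(i : EuclideanSpace ℝ (Fin d)) - (j : EuclideanSpace ℝ (Fin d))‖) ^ δ) ∧
       ∃ C : ℝ,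
        (∀ i : ↥I, (∑' j : ↥I,
          ‖A i j‖ * (1 + ‖(i : EuclideanSpace ℝ (Fin d)) - (j : EuclideanSpace ℝ (Fin d))‖) ^ δ) ≤ C) ∧
        (∀ j : ↥I, (∑' i : ↥I,
          ‖A i j‖ * (1 + ‖(i : EuclideanSpace ℝ (Fin d)) - (j : EuclideanSpace ℝ (Fin d))‖) ^ δ) ≤ C)}

/-- `ν : ℤ^d → [1,∞)` is an admissible weight: bounded below by `1`, sub-multiplicative,
symmetric, and satisfying the GRS condition. -/
def AdmissibleWeight {d : ℕ} (ν : (Fin d → ℤ) → ℝ) : Prop :=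
  (∀ x, 1 ≤ ν x) ∧
  (∀ x y, ν (x + y) ≤ ν x * ν y) ∧
  (∀ x, ν (-x) = ν x) ∧
  (∀ z : Fin d → ℤ, Filter.Tendsto (fun n : ℕ => (ν (n • z)) ^ ((n : ℝ)⁻¹))
    Filter.atTop (nhds 1))

/-- The Sjöstrand algebra `𝒞_ν` over `ℤ^d`:
matrices with `Σ_i sup_j |A_{j,j-i}| ν(i) < ∞`. -/
def SjostrandSet {d : ℕ} (ν : (Fin d → ℤ) → ℝ) :
    Set ((Fin d → ℤ) → (Fin d → ℤ) → ℂ) :=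
  {A | (∀ i : Fin d → ℤ, BddAbove (Set.range fun j : Fin d → ℤ => ‖A j (j - i)‖)) ∧
       Summable fun i : Fin d → ℤ => (⨆ j : Fin d → ℤ, ‖A j (j - i)‖) * ν i}


section AbstractJaffard

open ContinuousLinearMap

variable {ι E H : Type*}
  [NormedAddCommGroup E] [InnerProductSpace ℂ E] [CompleteSpace E]
  [NormedAddCommGroup H] [InnerProductSpace ℂ H] [CompleteSpace H]

/-- The `(i, j)` block of an operator `T` with respect to embeddings `U i : E → H`. -/
def block (U : ι → E →L[ℂ] H) (T : H →L[ℂ] H) (i j : ι) : E →L[ℂ] E :=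
  adjoint (U i) ∘L T ∘L U j

/-- The embeddings `U i` decompose `H` as an orthogonal direct sum of copies of `E`. -/
structure IsResolution (U : ι → E →L[ℂ] H) : Prop where
  norm_le : ∀ i, ‖U i‖ ≤ 1
  orth : ∀ i j, i ≠ j → adjoint (U i) ∘L U j = 0
  hasSum : ∀ x, HasSum (fun i => U i (adjoint (U i) x)) x

/-- The blocks of `T` decay like `a * (1 + dist i j) ^ (-s)`. -/
def Decay [PseudoMetricSpace ι] (U : ι → E →L[ℂ] H) (s : ℝ) (T : H →L[ℂ] H) (a : ℝ) : Prop :=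
  ∀ i j, ‖block U T i j‖ ≤ a * (1 + dist i j) ^ (-s)

/-- The weight `(1 + dist i j) ^ (-t)` has row sums bounded by `S`. -/
def SummableWeight (ι : Type*) [PseudoMetricSpace ι] (t S : ℝ) : Prop :=
  ∀ i : ι, Summable (fun k : ι => (1 + dist i k) ^ (-t)) ∧ ∑' k : ι, (1 + dist i k) ^ (-t) ≤ S

variable {U : ι → E →L[ℂ] H} {s t S a b : ℝ} {A B T Tinv : H →L[ℂ] H}

theorem block_add (i j : ι) : block U (A + B) i j = block U A i j + block U B i j := by
  ext; simp [block]

theorem block_smul (c : ℂ) (i j : ι) : block U (c • A) i j = c • block U A i j := by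
  ext; simp [block]

theorem block_adjoint (i j : ι) : block U (adjoint A) i j = adjoint (block U A j i) := by
  simp [block, adjoint_comp, comp_assoc]

theorem norm_block_le (hU : IsResolution U) (A : H →L[ℂ] H) (i j : ι) :
    ‖block U A i j‖ ≤ ‖A‖ := by
  have h1 : ‖adjoint (U i)‖ ≤ 1 := by simpa using hU.norm_le i
  have h2 := hU.norm_le j
  calc ‖block U A i j‖ ≤ ‖adjoint (U i)‖ * (‖A‖ * ‖U j‖) :=
        (opNorm_comp_le _ _).trans (by gcongr; exact opNorm_comp_le _ _)
    _ ≤ 1 * (‖A‖ * 1) := by gcongr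
    _ = ‖A‖ := by ring

theorem norm_block_mul_le (hU : IsResolution U) (i j : ι) {r : ℝ}
    (h : HasSum (fun k => ‖block U A i k‖ * ‖block U B k j‖) r) :
    ‖block U (A * B) i j‖ ≤ r := by
  refine opNorm_le_bound _ (h.nonneg fun k => by positivity) fun e => ?_
  have h1 := (hU.hasSum (B (U j e))).mapL (adjoint (U i) ∘L A)
  have h2 : block U (A * B) i j e = (adjoint (U i) ∘L A) (B (U j e)) := rfl
  rw [h2]
  refine h1.norm_le_of_bounded (h.mul_right ‖e‖) fun k => ?_
  have h3 : (adjoint (U i) ∘L A) (U k (adjoint (U k) (B (U j e)))) =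
      block U A i k (block U B k j e) := rfl
  rw [h3, mul_assoc]
  exact (le_opNorm _ _).trans (by gcongr; exact le_opNorm _ _)

variable [PseudoMetricSpace ι]

theorem Decay.mono (h : Decay U s A a) (hab : a ≤ b) : Decay U s A b := fun i j =>
  (h i j).trans (by gcongr)

theorem Decay.of_exponent_le (h : Decay U s A a) (ha : 0 ≤ a) (hts : t ≤ s) : Decay U t A a :=
  fun i j => (h i j).trans (by
    gcongr
    linarith [dist_nonneg (x := i) (y := j)])

theorem Decay.add (hA : Decay U s A a) (hB : Decay U s B b) : Decay U s (A + B) (a + b) := by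
  intro i j
  rw [block_add, add_mul]
  exact (norm_add_le _ _).trans (add_le_add (hA i j) (hB i j))

theorem Decay.smul (hA : Decay U s A a) (c : ℂ) : Decay U s (c • A) (‖c‖ * a) := by
  intro i j
  rw [block_smul, norm_smul, mul_assoc]
  gcongr
  exact hA i j

theorem Decay.adjoint (hA : Decay U s A a) : Decay U s (adjoint A) a := by
  intro i j
  rw [block_adjoint, dist_comm]
  simpa using hA j i

theorem Decay.one (hU : IsResolution U) : Decay U s 1 1 := by
  intro i j
  by_cases hij : i = j
  · subst hij
    simpa using (norm_block_le hU 1 i i).trans norm_id_le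
  · have : block U 1 i j = 0 := hU.orth i j hij
    rw [this, norm_zero]
    positivity

theorem rpow_neg_le_of_max {x y z : ℝ} (hs : 0 ≤ s) (hz : 0 < z)
    (hxyz : z ≤ x + y) (hyx : y ≤ x) : x ^ (-s) ≤ 2 ^ s * z ^ (-s) := by
  have h1 : z / 2 ≤ x := by linarith
  calc x ^ (-s) ≤ (z / 2) ^ (-s) := Real.rpow_le_rpow_of_nonpos (by positivity) h1 (by linarith)
    _ = 2 ^ s * z ^ (-s) := by
      rw [Real.div_rpow hz.le (by norm_num), Real.rpow_neg (by norm_num : (0:ℝ) ≤ 2)]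
      field_simp

theorem Decay.mul (hU : IsResolution U) (hs : 0 ≤ s) (hS : SummableWeight ι t S)
    {a' b' : ℝ} (ha : 0 ≤ a) (hb : 0 ≤ b) (ha' : 0 ≤ a') (hb' : 0 ≤ b')
    (hA : Decay U s A a) (hB : Decay U s B b) (hA' : Decay U t A a') (hB' : Decay U t B b') :
    Decay U s (A * B) (2 ^ s * S * (a * b' + a' * b)) := by
  intro i j
  set w := 2 ^ s * (1 + dist i j) ^ (-s) with hw
  have hw0 : 0 ≤ w := by positivity
  have key : ∀ k, ‖block U A i k‖ * ‖block U B k j‖ ≤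
      w * (a * b') * (1 + dist j k) ^ (-t) + w * (a' * b) * (1 + dist i k) ^ (-t) := by
    intro k
    have hi := dist_nonneg (x := i) (y := k)
    have hj := dist_nonneg (x := k) (y := j)
    have hd := dist_nonneg (x := i) (y := j)
    have htri := dist_triangle i k j
    rcases le_total (dist k j) (dist i k) with h | h
    · have h1 : (1 + dist i k) ^ (-s) ≤ w :=
        rpow_neg_le_of_max (y := 1 + dist k j) hs (by linarith) (by linarith) (by linarith)
      calc ‖block U A i k‖ * ‖block U B k j‖
          ≤ (a * w) * (b' * (1 + dist k j) ^ (-t)) := by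
            gcongr
            · exact (hA i k).trans (by gcongr)
            · exact hB' k j
        _ = w * (a * b') * (1 + dist j k) ^ (-t) := by rw [dist_comm k j]; ring
        _ ≤ _ := le_add_of_nonneg_right (by positivity)
    · have h1 : (1 + dist k j) ^ (-s) ≤ w :=
        rpow_neg_le_of_max (y := 1 + dist i k) hs (by linarith) (by linarith) (by linarith)
      calc ‖block U A i k‖ * ‖block U B k j‖
          ≤ (a' * (1 + dist i k) ^ (-t)) * (b * w) := by
            gcongr
            · exact hA' i k
            · exact (hB k j).trans (by gcongr)
        _ = w * (a' * b) * (1 + dist i k) ^ (-t) := by ring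
        _ ≤ _ := le_add_of_nonneg_left (by positivity)
  have hsum := ((hS j).1.mul_left (w * (a * b'))).add ((hS i).1.mul_left (w * (a' * b)))
  have hsum' := Summable.of_nonneg_of_le (fun k => by positivity) key hsum
  refine (norm_block_mul_le hU i j hsum'.hasSum).trans ((hsum'.tsum_le_tsum key hsum).trans ?_)
  rw [((hS j).1.mul_left _).tsum_add ((hS i).1.mul_left _), tsum_mul_left, tsum_mul_left]
  calc _ ≤ w * (a * b') * S + w * (a' * b) * S := by
        gcongr
        exacts [(hS j).2, (hS i).2]
    _ = _ := by rw [hw]; ring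

theorem Decay.interpolate (hU : IsResolution U) {θ α : ℝ} (hθ0 : 0 ≤ θ) (hθ1 : θ ≤ 1)
    (ha : 0 ≤ a) (hA : Decay U s A a) (hα : ‖A‖ ≤ α) :
    Decay U (s * θ) A (α ^ (1 - θ) * a ^ θ) := by
  intro i j
  set x := ‖block U A i j‖
  have hx : 0 ≤ x := norm_nonneg _
  have hd : 0 ≤ 1 + dist i j := by positivity
  calc x = x ^ (1 - θ) * x ^ θ := by
        rw [← Real.rpow_add_of_nonneg hx (by linarith) hθ0]; simp
    _ ≤ α ^ (1 - θ) * (a * (1 + dist i j) ^ (-s)) ^ θ := by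
        have h1 : x ≤ α := (norm_block_le hU A i j).trans hα
        have h2 := hA i j
        have hα0 : 0 ≤ α := hx.trans h1
        gcongr
    _ = _ := by
        rw [Real.mul_rpow ha (by positivity), ← Real.rpow_mul hd]
        ring_nf

theorem Decay.sq (hU : IsResolution U) {θ α : ℝ} (hθ0 : 0 ≤ θ) (hθ1 : θ ≤ 1) (hs : 0 ≤ s)
    (hS : SummableWeight ι (s * θ) S) (ha : 0 ≤ a) (hα0 : 0 ≤ α) (hα : ‖A‖ ≤ α)
    (hA : Decay U s A a) :
    Decay U s (A * A) (2 ^ s * S * 2 * (α ^ (1 - θ) * a ^ (1 + θ))) := by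
  have h' := hA.interpolate hU hθ0 hθ1 ha hα
  refine (Decay.mul hU hs hS ha ha (by positivity) (by positivity) hA hA h' h').mono (le_of_eq ?_)
  rw [Real.rpow_add_of_nonneg ha zero_le_one hθ0, Real.rpow_one]
  ring

theorem Decay.mul_self (hU : IsResolution U) {θ : ℝ} (hθ1 : θ ≤ 1) (hs : 0 ≤ s)
    (hS : SummableWeight ι (s * θ) S) (ha : 0 ≤ a) (hb : 0 ≤ b)
    (hA : Decay U s A a) (hB : Decay U s B b) :
    Decay U s (A * B) (2 ^ s * S * 2 * (a * b)) := by
  have hle : s * θ ≤ s := mul_le_of_le_one_right hs hθ1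
  refine (Decay.mul hU hs hS ha hb ha hb hA hB (hA.of_exponent_le ha hle)
    (hB.of_exponent_le hb hle)).mono (le_of_eq ?_)
  ring

/-- Iterated squaring: the decay constants of `A ^ 2 ^ k` are controlled by
`exp (β (1 + θ) ^ k - ρ 2 ^ k)`. -/
theorem Decay.pow_two_pow (hU : IsResolution U) {θ ρ : ℝ} (hθ0 : 0 < θ) (hθ1 : θ ≤ 1)
    (hs : 0 ≤ s) (hS : SummableWeight ι (s * θ) S) (hS0 : 0 < S) (hA : Decay U s A a)
    (hρ : ‖A‖ ≤ Real.exp (-ρ)) :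
    ∃ α β : ℝ, ∀ k : ℕ,
      Decay U s (A ^ 2 ^ k) (Real.exp (-α + β * (1 + θ) ^ k - ρ * 2 ^ k)) := by
  set γ := Real.log (2 ^ s * S * 2) with hγ
  have hγ' : 2 ^ s * S * 2 = Real.exp γ := (Real.exp_log (by positivity)).symm
  refine ⟨γ / θ, Real.log (max a 1) + γ / θ + ρ, fun k => ?_⟩
  induction k with
  | zero =>
    simp only [pow_zero, pow_one, mul_one]
    refine hA.mono ?_
    have : -(γ / θ) + (Real.log (max a 1) + γ / θ + ρ) - ρ = Real.log (max a 1) := by ring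
    rw [this, Real.exp_log (by positivity)]
    exact le_max_left _ _
  | succ k ih =>
    have hn : ‖A ^ 2 ^ k‖ ≤ Real.exp (-ρ * 2 ^ k) := by
      have h1 : ‖A ^ 2 ^ k‖ ≤ ‖A‖ ^ 2 ^ k := norm_pow_le' A (by positivity)
      refine h1.trans ((pow_le_pow_left₀ (norm_nonneg _) hρ _).trans (le_of_eq ?_))
      rw [← Real.exp_nat_mul]
      push_cast
      ring_nf
    have := ih.sq hU hθ0.le hθ1 hs hS (Real.exp_pos _).le (Real.exp_pos _).le hn
    rw [← pow_two, ← pow_mul, ← pow_succ] at this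
    refine this.mono (le_of_eq ?_)
    rw [hγ', ← Real.exp_mul, ← Real.exp_mul, ← Real.exp_add, ← Real.exp_add]
    congr 1
    field_simp
    ring

theorem exists_exp_lt {θ ρ : ℝ} (hθ0 : 0 < θ) (hθ1 : θ < 1) (hρ : 0 < ρ) (α β c : ℝ) (hc : 0 < c) :
    ∃ k : ℕ, c * Real.exp (-α + β * (1 + θ) ^ k - ρ * 2 ^ k) < 1 := by
  have h1 : Filter.Tendsto (fun k : ℕ => β * ((1 + θ) / 2) ^ k - ρ) Filter.atTop
      (nhds (β * 0 - ρ)) :=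
    ((tendsto_pow_atTop_nhds_zero_of_lt_one (by positivity) (by linarith)).const_mul β).sub_const ρ
  have h2 : Filter.Tendsto (fun k : ℕ => (2 : ℝ) ^ k * (β * ((1 + θ) / 2) ^ k - ρ)) Filter.atTop
      Filter.atBot :=
    (tendsto_pow_atTop_atTop_of_one_lt (by norm_num)).atTop_mul_neg (by linarith) h1
  obtain ⟨k, hk⟩ := (h2.eventually_lt_atBot (α - Real.log c)).exists
  refine ⟨k, ?_⟩
  nth_rewrite 1 [← Real.exp_log hc]
  rw [← Real.exp_add, Real.exp_lt_one_iff]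
  have : (2 : ℝ) ^ k * (β * ((1 + θ) / 2) ^ k - ρ) = β * (1 + θ) ^ k - ρ * 2 ^ k := by
    rw [div_pow]; field_simp
  linarith

theorem Decay.sum_pow (hU : IsResolution U) {c : ℝ} (hc : 0 ≤ c)
    (hmul : ∀ {A B : H →L[ℂ] H} {a b : ℝ}, 0 ≤ a → 0 ≤ b → Decay U s A a → Decay U s B b →
      Decay U s (A * B) (c * (a * b)))
    (ha : 0 ≤ a) (hA : Decay U s A a) (n : ℕ) :
    ∃ b, 0 ≤ b ∧ Decay U s (∑ i ∈ Finset.range n, A ^ i) b := by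
  induction n with
  | zero =>
    refine ⟨0, le_rfl, fun i j => ?_⟩
    simp [block]
  | succ n ih =>
    obtain ⟨b, hb, h⟩ := ih
    refine ⟨c * (a * b) + 1, by positivity, ?_⟩
    rw [Finset.sum_range_succ', pow_zero]
    simp only [pow_succ', ← Finset.mul_sum]
    exact (hmul ha hb hA h).add (Decay.one hU)

theorem Decay.tsum_pow (hU : IsResolution U) {c : ℝ} (hc : 0 ≤ c)
    (hmul : ∀ {A B : H →L[ℂ] H} {a b : ℝ}, 0 ≤ a → 0 ≤ b → Decay U s A a → Decay U s B b →
      Decay U s (A * B) (c * (a * b)))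
    (ha : 0 ≤ a) (hA : Decay U s A a) (hca : c * a < 1) (hnorm : ‖A‖ < 1) :
    ∃ b, 0 ≤ b ∧ Decay U s (∑' n : ℕ, A ^ n) b := by
  have hpow : ∀ n : ℕ, Decay U s (A ^ (n + 1)) (a * (c * a) ^ n) := by
    intro n
    induction n with
    | zero => simpa using hA
    | succ n ih =>
      rw [pow_succ]
      refine (hmul (by positivity) ha ih hA).mono (le_of_eq ?_)
      ring
  have hca0 : 0 ≤ c * a := by positivity
  have hgeo := (hasSum_geometric_of_lt_one hca0 hca).mul_left a
  have hb0 : 0 ≤ a * (1 - c * a)⁻¹ := hgeo.nonneg fun n => by positivity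
  have htail : Decay U s (∑' n : ℕ, A ^ (n + 1)) (a * (1 - c * a)⁻¹) := by
    intro i j
    have hs1 : Summable fun n : ℕ => A ^ (n + 1) :=
      (summable_nat_add_iff 1).2 (summable_geometric_of_norm_lt_one hnorm)
    refine opNorm_le_bound _ (by positivity) fun e => ?_
    have h1 : HasSum (fun n : ℕ => block U (A ^ (n + 1)) i j e)
        (block U (∑' n : ℕ, A ^ (n + 1)) i j e) :=
      (hs1.hasSum.mapL (ContinuousLinearMap.apply ℂ H (U j e))).mapL (ContinuousLinearMap.adjoint (U i))
    exact h1.norm_le_of_bounded ((hgeo.mul_right ((1 + dist i j) ^ (-s))).mul_right ‖e‖) fun n =>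
      (le_opNorm _ _).trans (by gcongr; exact hpow n i j)
  refine ⟨1 + a * (1 - c * a)⁻¹, by positivity, ?_⟩
  rw [(summable_geometric_of_norm_lt_one hnorm).tsum_eq_zero_add, pow_zero]
  exact (Decay.one hU).add htail

theorem norm_one_sub_smul_adjoint_mul_lt_one (hinv : Tinv * T = 1) :
    ∃ c : ℝ, ‖1 - (c : ℂ) • (adjoint T * T)‖ < 1 := by
  set τ := ‖T‖ + 1 with hτ
  set σ := ‖Tinv‖ + 1 with hσ
  have hτ0 : 0 < τ := by positivity
  have hσ0 : 0 < σ := by positivity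
  have hT : ∀ x, ‖x‖ ≤ σ * ‖T x‖ := fun x => by
    have h1 : Tinv (T x) = x := congrArg (fun F : H →L[ℂ] H => F x) hinv
    calc ‖x‖ = ‖Tinv (T x)‖ := by rw [h1]
      _ ≤ ‖Tinv‖ * ‖T x‖ := le_opNorm _ _
      _ ≤ σ * ‖T x‖ := by gcongr; linarith
  set c := (τ ^ 2)⁻¹ with hc
  have hc0 : 0 < c := by positivity
  have hcτ : c * τ ^ 2 = 1 := by rw [hc]; field_simp
  set q := max (1 - c / σ ^ 2) 0 with hq
  have hq1 : q < 1 := max_lt (by have : 0 < c / σ ^ 2 := by positivity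
                                 linarith) one_pos
  refine ⟨c, lt_of_le_of_lt (opNorm_le_bound _ (Real.sqrt_nonneg q) fun x => ?_)
    ((Real.sqrt_lt' one_pos).2 (by simpa using hq1))⟩
  have hadj : ‖adjoint T (T x)‖ ≤ τ * ‖T x‖ :=
    (le_opNorm _ _).trans (by gcongr; simp [hτ])
  have hinner : RCLike.re (inner ℂ x ((c : ℂ) • adjoint T (T x))) = c * ‖T x‖ ^ 2 := by
    rw [inner_smul_right, adjoint_inner_right, inner_self_eq_norm_sq_to_K]
    exact (RCLike.re_ofReal_mul (K := ℂ) c _).trans (by norm_cast)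
  have hexp : ‖(1 - (c : ℂ) • (adjoint T * T)) x‖ ^ 2 ≤ q * ‖x‖ ^ 2 := by
    have h1 : (1 - (c : ℂ) • (adjoint T * T)) x = x - (c : ℂ) • adjoint T (T x) := rfl
    rw [h1, norm_sub_sq (𝕜 := ℂ), hinner, norm_smul]
    have h2 : ‖(c : ℂ)‖ = c := by simp [abs_of_pos hc0]
    rw [h2]
    have h3 : (c * ‖adjoint T (T x)‖) ^ 2 ≤ c * ‖T x‖ ^ 2 := by
      calc (c * ‖adjoint T (T x)‖) ^ 2 ≤ (c * (τ * ‖T x‖)) ^ 2 := by gcongr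
        _ = c * (c * τ ^ 2) * ‖T x‖ ^ 2 := by ring
        _ = _ := by rw [hcτ, mul_one]
    have h4 : c / σ ^ 2 * ‖x‖ ^ 2 ≤ c * ‖T x‖ ^ 2 := by
      calc c / σ ^ 2 * ‖x‖ ^ 2 ≤ c / σ ^ 2 * (σ * ‖T x‖) ^ 2 := by gcongr; exact hT x
        _ = _ := by field_simp
    have h5 : (1 - c / σ ^ 2) * ‖x‖ ^ 2 ≤ q * ‖x‖ ^ 2 := by
      gcongr; exact le_max_left _ _
    nlinarith
  have hq0 : 0 ≤ q := le_max_right _ _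
  refine abs_le_of_sq_le_sq' ?_ (by positivity) |>.2
  rw [mul_pow, Real.sq_sqrt hq0]
  exact hexp

/-- Jaffard's theorem for operator-valued matrices. -/
theorem Decay.inverse (hU : IsResolution U) {θ : ℝ} (hθ0 : 0 < θ) (hθ1 : θ < 1)
    (hs : 0 ≤ s) (hS : SummableWeight ι (s * θ) S) (hT : Decay U s T a)
    (hleft : Tinv * T = 1) (hright : T * Tinv = 1) :
    ∃ b, Decay U s Tinv b := by
  wlog hS0 : 0 < S generalizing S
  · exact this (S := max S 1) (fun i => ⟨(hS i).1, (hS i).2.trans (le_max_left _ _)⟩)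
      (by positivity)
  wlog ha : 0 ≤ a generalizing a
  · exact this (a := max a 0) (hT.mono (le_max_left _ _)) (le_max_right _ _)
  have hc : (0 : ℝ) < 2 ^ s * S * 2 := by positivity
  have hmul : ∀ {A B : H →L[ℂ] H} {a b : ℝ}, 0 ≤ a → 0 ≤ b → Decay U s A a → Decay U s B b →
      Decay U s (A * B) (2 ^ s * S * 2 * (a * b)) :=
    fun ha hb hA hB => hA.mul_self hU hθ1.le hs hS ha hb hB
  obtain ⟨c, hR⟩ := norm_one_sub_smul_adjoint_mul_lt_one hleft
  set R := 1 - (c : ℂ) • (ContinuousLinearMap.adjoint T * T) with hRdef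
  obtain ⟨r, hr, hRdec⟩ : ∃ r, 0 ≤ r ∧ Decay U s R r := by
    have h1 := (Decay.one (s := s) hU).add ((hmul ha ha hT.adjoint hT).smul (-(c : ℂ)))
    refine ⟨_, ?_, by rwa [neg_smul, ← sub_eq_add_neg, ← hRdef] at h1⟩
    positivity
  obtain ⟨ρ, hρ0, hρ⟩ : ∃ ρ : ℝ, 0 < ρ ∧ ‖R‖ ≤ Real.exp (-ρ) := by
    have h1 : 0 < max ‖R‖ (1 / 2) := by positivity
    refine ⟨-Real.log (max ‖R‖ (1 / 2)), ?_, ?_⟩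
    · rw [neg_pos]
      exact Real.log_neg h1 (max_lt hR (by norm_num))
    · rw [neg_neg, Real.exp_log h1]
      exact le_max_left _ _
  obtain ⟨α, β, hpow⟩ := hRdec.pow_two_pow hU hθ0 hθ1.le hs hS hS0 hρ
  obtain ⟨k, hk⟩ := exists_exp_lt hθ0 hθ1 hρ0 α β _ hc
  have hRk : ‖R ^ 2 ^ k‖ < 1 :=
    (norm_pow_le' R (by positivity)).trans_lt (pow_lt_one₀ (norm_nonneg _) hR (by positivity))
  obtain ⟨g₁, hg₁, hG₁⟩ :=
    (hpow k).tsum_pow hU hc.le hmul (Real.exp_pos _).le hk hRk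
  obtain ⟨g₂, hg₂, hG₂⟩ := hRdec.sum_pow hU hc.le hmul hr (2 ^ k)
  have hG := (hmul (by positivity) ha (hmul hg₁ hg₂ hG₁ hG₂) hT.adjoint).smul (c : ℂ)
  have hone : (∑' n : ℕ, (R ^ 2 ^ k) ^ n) * (∑ i ∈ Finset.range (2 ^ k), R ^ i) * (1 - R) = 1 := by
    rw [mul_assoc, geom_sum_mul_neg, geom_series_mul_neg _ hRk]
  have h1R : 1 - R = (c : ℂ) • (ContinuousLinearMap.adjoint T * T) := by rw [hRdef]; abel
  rw [h1R] at hone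
  have heq : Tinv = (c : ℂ) • ((∑' n : ℕ, (R ^ 2 ^ k) ^ n) *
      (∑ i ∈ Finset.range (2 ^ k), R ^ i) * ContinuousLinearMap.adjoint T) := calc
    Tinv = 1 * Tinv := (one_mul _).symm
    _ = _ := by
      rw [← hone]
      simp only [mul_smul_comm, smul_mul_assoc, mul_assoc, hright, mul_one]
  exact ⟨_, by rw [heq]; exact hG⟩

end AbstractJaffard

section LatticeSum

theorem summable_one_add_abs_int_rpow {p : ℝ} (hp : 1 < p) :
    Summable fun m : ℤ => (1 + |(m : ℝ)|) ^ (-p) := by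
  have h := (Real.summable_abs_int_rpow hp).add (summable_of_ne_finset_zero (s := {(0 : ℤ)})
    (f := fun m : ℤ => if m = 0 then (1 : ℝ) else 0) (by simp_all))
  refine Summable.of_nonneg_of_le (fun m => by positivity) (fun m => ?_) h
  by_cases hm : m = 0
  · simp only [hm, Int.cast_zero, abs_zero, add_zero, Real.one_rpow, if_true]
    have : (0 : ℝ) ≤ 0 ^ (-p) := by positivity
    linarith
  · simp only [hm, if_false, add_zero]
    have h1 : (0 : ℝ) < |(m : ℝ)| := by positivity
    exact Real.rpow_le_rpow_of_nonpos h1 (by linarith) (by linarith)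

theorem sum_prod_le_pow {d : ℕ} {f : ℤ → ℝ} (hf : Summable f) (hf0 : ∀ m, 0 ≤ f m)
    (F : Finset (Fin d → ℤ)) : ∑ n ∈ F, ∏ l, f (n l) ≤ (∑' m, f m) ^ d := by
  classical
  let G : Fin d → Finset ℤ := fun l => F.image fun n => n l
  calc ∑ n ∈ F, ∏ l, f (n l) ≤ ∑ n ∈ Fintype.piFinset G, ∏ l, f (n l) := by
        refine Finset.sum_le_sum_of_subset_of_nonneg (fun n hn => ?_)
          fun n _ _ => Finset.prod_nonneg fun l _ => hf0 _
        exact Fintype.mem_piFinset.2 fun l => Finset.mem_image_of_mem (fun n => n l) hn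
    _ = ∏ l, ∑ m ∈ G l, f m := (Finset.prod_univ_sum G fun _ m => f m).symm
    _ ≤ ∏ _l : Fin d, ∑' m, f m :=
        Finset.prod_le_prod (fun l _ => Finset.sum_nonneg fun m _ => hf0 m)
          fun l _ => hf.sum_le_tsum _ fun m _ => hf0 m
    _ = _ := by simp

theorem one_add_norm_rpow_le_prod {d : ℕ} (hd : 1 ≤ d) {t : ℝ} (ht : 0 ≤ t)
    (x : EuclideanSpace ℝ (Fin d)) :
    (1 + ‖x‖) ^ (-t) ≤ 2 ^ t * ∏ l, (1 + |((⌊x l⌋ : ℤ) : ℝ)|) ^ (-(t / d)) := by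
  have hd' : (d : ℝ) ≠ 0 := by positivity
  have h1 : ∀ l, ((1 + ‖x‖) * 2) ^ (-(t / d)) ≤ (1 + |((⌊x l⌋ : ℤ) : ℝ)|) ^ (-(t / d)) := by
    intro l
    refine Real.rpow_le_rpow_of_nonpos (by positivity) ?_ (neg_nonpos.2 (by positivity))
    have h2 : |x l| ≤ ‖x‖ := by simpa using PiLp.norm_apply_le x l
    have h3 := Int.floor_le (x l)
    have h4 := Int.lt_floor_add_one (x l)
    have h5 := abs_le.1 h2
    have h6 : |((⌊x l⌋ : ℤ) : ℝ)| ≤ ‖x‖ + 1 := abs_le.2 ⟨by linarith, by linarith⟩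
    linarith [norm_nonneg x]
  have h2 := Finset.prod_le_prod (s := Finset.univ) (fun l _ => by positivity) fun l _ => h1 l
  rw [Finset.prod_const, Finset.card_univ, Fintype.card_fin, ← Real.rpow_natCast,
    ← Real.rpow_mul (by positivity), show -(t / d) * d = -t by field_simp,
    Real.mul_rpow (by positivity) (by norm_num)] at h2
  calc (1 + ‖x‖) ^ (-t) = 2 ^ t * ((1 + ‖x‖) ^ (-t) * 2 ^ (-t)) := by
        rw [Real.rpow_neg (by norm_num : (0 : ℝ) ≤ 2)]; field_simp
    _ ≤ _ := by gcongr

theorem RelSeparated.summableWeight {d : ℕ} (hd : 1 ≤ d) {I : Set (EuclideanSpace ℝ (Fin d))}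
    (hI : RelSeparated I) {t : ℝ} (ht : (d : ℝ) < t) : ∃ S, SummableWeight I t S := by
  classical
  obtain ⟨N, hN⟩ := hI
  have hd' : (0 : ℝ) < d := by positivity
  have ht0 : 0 ≤ t := by linarith
  set f : ℤ → ℝ := fun m => (1 + |(m : ℝ)|) ^ (-(t / d)) with hf
  have hfs : Summable f := summable_one_add_abs_int_rpow ((one_lt_div hd').2 ht)
  have hf0 : ∀ m, 0 ≤ f m := fun m => by positivity
  have hbound : ∀ i : I, ∀ F : Finset I,
      ∑ k ∈ F, (1 + dist i k) ^ (-t) ≤ N * (2 ^ t * (∑' m, f m) ^ d) := by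
    intro i F
    let φ : I → Fin d → ℤ := fun k l => ⌊((k : EuclideanSpace ℝ (Fin d)) - i) l⌋
    have hfib : ∀ n : Fin d → ℤ, ((F.filter fun k => φ k = n).card : ℝ) ≤ N := by
      intro n
      let x : EuclideanSpace ℝ (Fin d) :=
        WithLp.toLp 2 fun l => (i : EuclideanSpace ℝ (Fin d)) l + n l
      have h1 : ((F.filter fun k => φ k = n).image Subtype.val : Set _) ⊆
          I ∩ {y | ∀ l : Fin d, y l ∈ Set.Icc (x l) (x l + 1)} := by
        intro y hy
        simp only [Finset.coe_image, Finset.coe_filter, Set.mem_image, Set.mem_ofPred_eq] at hy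
        obtain ⟨k, ⟨-, hk⟩, rfl⟩ := hy
        refine ⟨k.2, fun l => ?_⟩
        have h2 : ⌊((k : EuclideanSpace ℝ (Fin d)) - i) l⌋ = n l := congrFun hk l
        rw [Int.floor_eq_iff] at h2
        simp only [PiLp.sub_apply] at h2
        constructor <;> simp only [x] <;> linarith [h2.1, h2.2]
      have h3 := (Set.ncard_le_ncard h1 (hN x).1).trans (hN x).2
      rw [Set.ncard_coe_finset, Finset.card_image_of_injective _ Subtype.val_injective] at h3
      exact_mod_cast h3
    calc ∑ k ∈ F, (1 + dist i k) ^ (-t) ≤ ∑ k ∈ F, 2 ^ t * ∏ l, f (φ k l) := by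
          refine Finset.sum_le_sum fun k _ => ?_
          rw [dist_comm, Subtype.dist_eq, dist_eq_norm]
          exact one_add_norm_rpow_le_prod hd ht0 _
      _ = 2 ^ t * ∑ n ∈ F.image φ, ∑ k ∈ F with φ k = n, ∏ l, f (φ k l) := by
          rw [← Finset.mul_sum, Finset.sum_fiberwise_of_maps_to
            (fun k hk => Finset.mem_image_of_mem φ hk)]
      _ ≤ 2 ^ t * ∑ n ∈ F.image φ, N * ∏ l, f (n l) := by
          gcongr with n _
          have h1 : ∑ k ∈ F with φ k = n, ∏ l, f (φ k l) =
              ∑ k ∈ F with φ k = n, ∏ l, f (n l) :=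
            Finset.sum_congr rfl fun k hk => by rw [(Finset.mem_filter.1 hk).2]
          rw [h1, Finset.sum_const, nsmul_eq_mul]
          exact mul_le_mul_of_nonneg_right (hfib n) (Finset.prod_nonneg fun l _ => hf0 _)
      _ = N * (2 ^ t * ∑ n ∈ F.image φ, ∏ l, f (n l)) := by
          rw [← Finset.mul_sum]; ring
      _ ≤ _ := by gcongr; exact sum_prod_le_pow hfs hf0 _
  refine ⟨N * (2 ^ t * (∑' m, f m) ^ d), fun i => ?_⟩
  have hs := summable_of_sum_le (fun k => by positivity) (hbound i)
  exact ⟨hs, hs.tsum_le_of_sum_le (hbound i)⟩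

end LatticeSum

section Blocks

open ContinuousLinearMap

variable {ι κ J : Type*}

theorem summable_norm_sq (c : L2 J) : Summable fun j => ‖(c : ∀ _ : J, ℂ) j‖ ^ (2 : ℝ) := by
  simpa using (lp.memℓp c).summable (by norm_num)

theorem norm_extend_rpow (f : κ → J) (c : κ → ℂ) :
    (fun j => ‖Function.extend f c 0 j‖ ^ (2 : ℝ)) =
      Function.extend f (fun k => ‖c k‖ ^ (2 : ℝ)) 0 := by
  classical
  ext j
  by_cases h : ∃ k, f k = j <;> simp [Function.extend_def, h]

/-- Extension by zero along an injective map, as an operator between `ℓ²` spaces. -/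
def extendZero (f : κ → J) (hf : Function.Injective f) : L2 κ →L[ℂ] L2 J :=
  LinearMap.mkContinuous
    { toFun := fun c => ⟨Function.extend f c 0, memℓp_gen (by
        have h := (summable_extend_zero hf).2 (summable_norm_sq c)
        rw [← norm_extend_rpow] at h
        simpa using h)⟩
      map_add' := fun c c' => by
        ext j
        change Function.extend f (fun k => c k + c' k) 0 j =
          Function.extend f c 0 j + Function.extend f c' 0 j
        by_cases h : ∃ k, f k = j
        · obtain ⟨k, rfl⟩ := h
          simp [hf.extend_apply]
        · simp [Function.extend_apply' _ _ _ h]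
      map_smul' := fun z c => by
        ext j
        change Function.extend f (fun k => z • c k) 0 j = z • Function.extend f c 0 j
        by_cases h : ∃ k, f k = j
        · obtain ⟨k, rfl⟩ := h
          simp [hf.extend_apply]
        · simp [Function.extend_apply' _ _ _ h] } 1 (fun c => by
    rw [one_mul]
    refine lp.norm_le_of_tsum_le (by norm_num) (norm_nonneg _) ?_
    rw [lp.norm_rpow_eq_tsum (by norm_num)]
    have h := congrArg tsum (norm_extend_rpow f c)
    rw [tsum_extend_zero hf] at h
    simpa using h.le)

variable {f : κ → J} (hf : Function.Injective f)

theorem extendZero_apply (c : L2 κ) (k : κ) :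
    (extendZero f hf c : ∀ _ : J, ℂ) (f k) = (c : ∀ _ : κ, ℂ) k :=
  hf.extend_apply _ _ _

theorem extendZero_apply_of_notMem (c : L2 κ) {j : J} (hj : j ∉ Set.range f) :
    (extendZero f hf c : ∀ _ : J, ℂ) j = 0 :=
  Function.extend_apply' _ _ _ hj

theorem norm_extendZero_le : ‖extendZero f hf‖ ≤ 1 :=
  LinearMap.mkContinuous_norm_le _ zero_le_one _

theorem extendZero_single [DecidableEq κ] [DecidableEq J] (k : κ) (z : ℂ) :
    extendZero f hf (lp.single 2 k z) = lp.single 2 (f k) z := by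
  ext j
  by_cases h : j ∈ Set.range f
  · obtain ⟨l, rfl⟩ := h
    simp [extendZero_apply, Pi.single_apply, hf.eq_iff]
  · rw [extendZero_apply_of_notMem hf _ h, lp.single_apply_ne]
    rintro rfl
    exact h ⟨k, rfl⟩

theorem adjoint_extendZero_apply (x : L2 J) (k : κ) :
    (adjoint (extendZero f hf) x : ∀ _ : κ, ℂ) k = (x : ∀ _ : J, ℂ) (f k) := by
  classical
  have h := adjoint_inner_right (extendZero f hf) (lp.single 2 k (1 : ℂ)) x
  rw [extendZero_single, lp.inner_single_left, lp.inner_single_left] at h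
  simpa using h

theorem hasSum_single_smul [DecidableEq J] (c : L2 J) :
    HasSum (fun j => (c : ∀ _ : J, ℂ) j • lp.single (E := fun _ : J => ℂ) 2 j (1 : ℂ)) c := by
  simpa [← lp.single_smul] using lp.hasSum_single (by norm_num) c

theorem represents_unique {M : κ → κ → ℂ} {T T' : L2 κ →L[ℂ] L2 κ} (h : Represents M T)
    (h' : Represents M T') : T = T' := by
  ext c k
  exact (h c k).unique (h' c k)

theorem opNorm2_eq {M : κ → κ → ℂ} {T : L2 κ →L[ℂ] L2 κ} (h : Represents M T) :
    opNorm2 M = ‖T‖ := by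
  have hb : Bounded2 M := ⟨T, h⟩
  rw [opNorm2, dif_pos hb, represents_unique hb.choose_spec h]

theorem represents_matrix [DecidableEq J] (T : L2 J →L[ℂ] L2 J) :
    Represents (fun p q => (T (lp.single 2 q (1 : ℂ)) : ∀ _ : J, ℂ) p) T := by
  intro c k
  have h := (hasSum_single_smul c).mapL (lp.evalCLM ℂ (fun _ : J => ℂ) 2 k ∘L T)
  have hq : ∀ q, (T (lp.single 2 q (1 : ℂ)) : ∀ _ : J, ℂ) k * (c : ∀ _ : J, ℂ) q =
      (lp.evalCLM ℂ (fun _ : J => ℂ) 2 k ∘L T) ((c : ∀ _ : J, ℂ) q • lp.single 2 q (1 : ℂ)) := by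
    intro q
    rw [map_smul, smul_eq_mul, mul_comm]
    rfl
  simp only [hq]
  exact h

/-- The embedding of the `i`-th block of `ℓ²(J)` under an identification `ι × κ ≃ J`. -/
def blockEmb (e : ι × κ ≃ J) (i : ι) : L2 κ →L[ℂ] L2 J :=
  extendZero (fun k => e (i, k)) fun k l h => by simpa using h

theorem blockEmb_apply (e : ι × κ ≃ J) (i : ι) (c : L2 κ) (k : κ) :
    (blockEmb e i c : ∀ _ : J, ℂ) (e (i, k)) = (c : ∀ _ : κ, ℂ) k :=
  extendZero_apply (f := fun k => e (i, k)) _ c k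

theorem blockEmb_apply_of_ne (e : ι × κ ≃ J) {i i' : ι} (h : i ≠ i') (c : L2 κ) (k : κ) :
    (blockEmb e i' c : ∀ _ : J, ℂ) (e (i, k)) = 0 := by
  refine extendZero_apply_of_notMem _ c ?_
  rintro ⟨l, hl⟩
  exact h (congrArg Prod.fst (e.injective hl)).symm

theorem adjoint_blockEmb_apply (e : ι × κ ≃ J) (i : ι) (x : L2 J) (k : κ) :
    (adjoint (blockEmb e i) x : ∀ _ : κ, ℂ) k = (x : ∀ _ : J, ℂ) (e (i, k)) :=
  adjoint_extendZero_apply (f := fun k => e (i, k)) _ x k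

theorem blockEmb_single [DecidableEq κ] [DecidableEq J] (e : ι × κ ≃ J) (i : ι) (k : κ) (z : ℂ) :
    blockEmb e i (lp.single 2 k z) = lp.single 2 (e (i, k)) z :=
  extendZero_single (f := fun k => e (i, k)) _ k z

theorem isResolution_blockEmb (e : ι × κ ≃ J) : IsResolution (blockEmb e) where
  norm_le i := norm_extendZero_le _
  orth i j hij := by
    ext c k
    exact (adjoint_blockEmb_apply e i _ k).trans (blockEmb_apply_of_ne e hij c k)
  hasSum x := by
    classical
    have h := lp.hasSum_single (E := fun _ : J => ℂ) (p := 2) (by norm_num) x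
    rw [← e.hasSum_iff] at h
    refine h.prod_fiberwise fun i => ?_
    have h1 := (lp.hasSum_single (E := fun _ : κ => ℂ) (p := 2) (by norm_num)
      (adjoint (blockEmb e i) x)).mapL (blockEmb e i)
    convert h1 using 2 with k
    rw [blockEmb_single, adjoint_blockEmb_apply]
    rfl

theorem represents_block (e : ι × κ ≃ J) {M : J → J → ℂ} {T : L2 J →L[ℂ] L2 J}
    (h : Represents M T) (i j : ι) :
    Represents (fun k l => M (e (i, k)) (e (j, l))) (block (blockEmb e) T i j) := by
  intro c k
  have hinj : Function.Injective fun l => e (j, l) := fun k l h => by simpa using h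
  have h1 := h (blockEmb e j c) (e (i, k))
  have hzero : ∀ x ∉ Set.range fun l => e (j, l),
      M (e (i, k)) x * (blockEmb e j c : ∀ _ : J, ℂ) x = 0 := by
    intro x hx
    obtain ⟨⟨i', l⟩, rfl⟩ := e.surjective x
    rw [blockEmb_apply_of_ne e (fun hi => hx ⟨l, by rw [hi]⟩), mul_zero]
  rw [← hinj.hasSum_iff hzero] at h1
  have h2 : (block (blockEmb e) T i j c : ∀ _ : κ, ℂ) k =
      (T (blockEmb e j c) : ∀ _ : J, ℂ) (e (i, k)) :=
    adjoint_blockEmb_apply e i _ k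
  rw [h2]
  convert h1 using 2 with l
  rw [Function.comp_apply, blockEmb_apply]

end Blocks

theorem mem_jaffardSet_ofReal_iff {d : ℕ} {I : Set (EuclideanSpace ℝ (Fin d))} {s : ℝ}
    {x : I → I → ℝ} (hx : ∀ i j, 0 ≤ x i j) :
    (fun i j => (x i j : ℂ)) ∈ JaffardSet I s ↔
      ∃ C, ∀ i j, x i j ≤ C * (1 + dist i j) ^ (-s) := by
  refine exists_congr fun C => forall₂_congr fun i j => ?_
  have h : 0 < 1 + dist i j := by positivity
  rw [Complex.norm_of_nonneg (hx i j), ← dist_eq_norm, ← Subtype.dist_eq, Real.rpow_neg h.le,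
    ← div_eq_mul_inv, le_div_iff₀ (by positivity)]

/-- Inverse-closedness of the block-wise Jaffard class: if the operator norms of the blocks of a
boundedly invertible matrix have polynomial decay, then so do those of its inverse. -/
theorem jaffard_block_inverse {d : ℕ} (hd : 1 ≤ d) {I : Set (EuclideanSpace ℝ (Fin d))}
    (hI : RelSeparated I) {s : ℝ} (hs : (d : ℝ) < s) {κ J : Type*} (e : I × κ ≃ J)
    {M N : J → J → ℂ} {T Tinv : L2 J →L[ℂ] L2 J} (hM : Represents M T)
    (hN : Represents N Tinv) (hleft : Tinv * T = 1) (hright : T * Tinv = 1)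
    (h : (fun i j => (opNorm2 (fun k l => M (e (i, k)) (e (j, l))) : ℂ)) ∈ JaffardSet I s) :
    (∀ i j, Bounded2 (fun k l => N (e (i, k)) (e (j, l)))) ∧
      (fun i j => (opNorm2 (fun k l => N (e (i, k)) (e (j, l))) : ℂ)) ∈ JaffardSet I s := by
  refine ⟨fun i j => ⟨_, represents_block e hN i j⟩, ?_⟩
  simp only [opNorm2_eq (represents_block e hM _ _)] at h
  simp only [opNorm2_eq (represents_block e hN _ _)]
  rw [mem_jaffardSet_ofReal_iff fun _ _ => norm_nonneg _] at h ⊢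
  obtain ⟨a, ha⟩ := h
  have hs0 : 0 < s := (Nat.cast_nonneg d).trans_lt hs
  have hd0 : 0 ≤ (d : ℝ) / s := by positivity
  have hd1 : (d : ℝ) / s < 1 := (div_lt_one hs0).2 hs
  obtain ⟨S, hS⟩ := hI.summableWeight hd (t := s * ((d / s + 1) / 2)) (by field_simp; linarith)
  exact Decay.inverse (isResolution_blockEmb e) (by linarith) (by linarith) hs0.le hS ha
    hleft hright

/-- the tensor algebra built from two Jaffard algebras is inverse-closed. -/
theorem statement1 {d : ℕ} (hd : 1 ≤ d)
    (I₁ I₂ : Set (EuclideanSpace ℝ (Fin d)))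
    (hI₁ : RelSeparated I₁) (hI₂ : RelSeparated I₂)
    (s₁ s₂ : ℝ) (hs₁ : (d : ℝ) < s₁) (hs₂ : (d : ℝ) < s₂) :
    InverseClosed {A : Tensor ↥I₁ ↥I₂ |
      MemT1 (JaffardSet I₁ s₁) A ∧ MemT2 (JaffardSet I₂ s₂) A} := by
  rintro A ⟨⟨-, hA₁⟩, ⟨-, hA₂⟩⟩ T Tinv hT hright hleft
  have hinv : Represents (toMatrix (entryTensor Tinv)) Tinv :=
    @represents_matrix _ (Classical.decEq _) Tinv
  have h₁ := jaffard_block_inverse hd hI₁ hs₁ (Equiv.refl (I₁ × I₂)) hT hinv hleft hright hA₁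
  have h₂ := jaffard_block_inverse hd hI₂ hs₂ (Equiv.prodComm I₂ I₁) hT hinv hleft hright hA₂
  exact ⟨h₁, h₂⟩

end PaperTensor
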